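/- There exist absolute constants C, c > 0 such that the following holds. Let q ≡ 3 (mod 4) be a prime power and let E ⊆ P_3 ⊆ 𝔽_q^3. If |E| ≥ C q^{4/3}, then |∏(E)| ≥ c q. -/

import Mathlib

open Finset

/-- Dot product `x·y = x₁y₁ + ⋯ + xₙyₙ` on `𝔽_q^n`. -/
def dotP {F : Type*} [CommRing F] {n : ℕ} (x y : Fin n → F) : F := ∑ i, x i * y i

/-- The "norm" `‖x‖ = x₁² + ⋯ + xₙ²` on `𝔽_q^n`. -/
def nrm {F : Type*} [CommRing F] {n : ℕ} (x : Fin n → F) : F := ∑ i, x i * x i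

/-- The sphere `S_r = {x ∈ 𝔽_q^n : ‖x‖ = r}`. -/
def sph (F : Type*) [CommRing F] [Fintype F] [DecidableEq F] (n : ℕ) (r : F) :
    Finset (Fin n → F) := Finset.univ.filter fun x => nrm x = r

/-- The dot product set `∏(E) = {x·y : x, y ∈ E}`. -/
def prodSet {F : Type*} [CommRing F] [DecidableEq F] {n : ℕ} (E : Finset (Fin n → F)) :
    Finset F := (E ×ˢ E).image fun p => dotP p.1 p.2

/-- Fourier transform of the indicator function of `X`:
`X̂(m) = q^{-n} ∑_{x ∈ X} χ(-x·m)`. -/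
noncomputable def fourierCoef {F : Type*} [CommRing F] [Fintype F] {n : ℕ}
    (χ : AddChar F ℂ) (X : Finset (Fin n → F)) (m : Fin n → F) : ℂ :=
  ((Fintype.card F : ℂ) ^ n)⁻¹ * ∑ x ∈ X, χ (-(dotP x m))

section Counting

variable {ι α : Type*} [DecidableEq α]

/-- The pairs of indices in `I` with the same value under `f`. -/
def coincidences (I : Finset ι) (f : ι → α) : Finset (ι × ι) :=
  (I ×ˢ I).filter fun p => f p.1 = f p.2

theorem sum_card_fiber_sq (I : Finset ι) (f : ι → α) (T : Finset α) (h : ∀ i ∈ I, f i ∈ T) :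
    ∑ y ∈ T, #{i ∈ I | f i = y} ^ 2 = #(coincidences I f) := by
  classical
  rw [Finset.card_eq_sum_card_fiberwise (f := fun p : ι × ι => f p.1) (t := T)]
  · refine Finset.sum_congr rfl fun y _ => ?_
    rw [sq, ← Finset.card_product]
    congr 1
    ext ⟨i, j⟩
    simp only [coincidences, mem_product, mem_filter]
    grind
  · rintro ⟨i, j⟩ hp
    simp only [coincidences, coe_filter, mem_product, Set.mem_ofPred_eq] at hp
    exact h _ hp.1.1

theorem card_sq_le_card_mul_card_coincidences (I : Finset ι) (f : ι → α) (T : Finset α)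
    (h : ∀ i ∈ I, f i ∈ T) : #I ^ 2 ≤ #T * #(coincidences I f) := by
  rw [← sum_card_fiber_sq I f T h, Finset.card_eq_sum_card_fiberwise (f := f) (t := T) h]
  exact sq_sum_le_card_mul_sum_sq

end Counting

section DotProduct

variable {R : Type*} [CommRing R] {n : ℕ}

theorem dotP_sub_right (u v w : Fin n → R) : dotP u (v - w) = dotP u v - dotP u w := by
  simp [dotP, mul_sub]

theorem dotP_add_left (u v w : Fin n → R) : dotP (u + v) w = dotP u w + dotP v w := by
  simp [dotP, add_mul, Finset.sum_add_distrib]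

theorem dotP_smul_smul (a b : R) (u v : Fin n → R) :
    dotP (a • u) (b • v) = a * (b * dotP u v) := by
  simp only [dotP, Pi.smul_apply, smul_eq_mul, Finset.mul_sum]
  exact Finset.sum_congr rfl fun i _ => by ring

end DotProduct

section CharacterSums

variable {F : Type*} [Field F] [Fintype F] [DecidableEq F] {n : ℕ}

theorem sum_addChar_dotP {χ : AddChar F ℂ} (hχ : χ ≠ 0) (z : Fin n → F) :
    ∑ u, χ (dotP u z) = if z = 0 then (Fintype.card F : ℂ) ^ n else 0 := by
  let φ : (Fin n → F) →+ F :=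
    { toFun := fun u => dotP u z
      map_zero' := by simp [dotP]
      map_add' := fun u v => dotP_add_left u v z }
  have key := AddChar.sum_eq_ite (χ.compAddMonoidHom φ)
  have hiff : χ.compAddMonoidHom φ = 0 ↔ z = 0 := by
    constructor
    · intro h
      by_contra hz
      obtain ⟨k, hk⟩ := Function.ne_iff.mp hz
      apply hχ
      ext a
      have := DFunLike.congr_fun h (Pi.single k (a / z k))
      have h2 : φ (Pi.single k (a / z k)) = a := by
        change dotP _ _ = _
        simp only [dotP]
        rw [Finset.sum_eq_single k]
        · rw [Pi.single_eq_same]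
          exact div_mul_cancel₀ a hk
        · intro b _ hb
          rw [Pi.single_eq_of_ne hb, zero_mul]
        · simp
      simpa [h2] using this
    · rintro rfl
      ext u
      have : φ u = 0 := by change dotP _ _ = _; simp [dotP]
      simp [this]
  simp only [hiff] at key
  simpa [φ] using key

theorem norm_sq_sum_addChar_dotP_le {ι κ : Type*} {χ : AddChar F ℂ} (hχ : χ ≠ 0)
    (I : Finset ι) (J : Finset κ) (U : ι → Fin n → F) (W : κ → Fin n → F) :
    ‖∑ i ∈ I, ∑ j ∈ J, χ (dotP (U i) (W j))‖ ^ 2 ≤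
      (Fintype.card F : ℝ) ^ n * #(coincidences I U) * #(coincidences J W) := by
  set g : (Fin n → F) → ℂ := fun u => ∑ j ∈ J, χ (dotP u (W j)) with hg
  have h1 : ∑ i ∈ I, g (U i) = ∑ u, (#{i ∈ I | U i = u} : ℂ) * g u := by
    rw [← Finset.sum_fiberwise I U]
    refine Finset.sum_congr rfl fun u _ => ?_
    rw [Finset.sum_congr rfl (g := fun _ => g u) (fun i hi => by rw [(mem_filter.mp hi).2])]
    simp
  have h2 : ∑ u, ‖g u‖ ^ 2 = (Fintype.card F : ℝ) ^ n * #(coincidences J W) := by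
    have : ((∑ u, ‖g u‖ ^ 2 : ℝ) : ℂ) =
        (((Fintype.card F : ℝ) ^ n * #(coincidences J W) : ℝ) : ℂ) := by
      push_cast
      have e : ∀ u, (‖g u‖ : ℂ) ^ 2 = ∑ p ∈ J ×ˢ J, χ (dotP u (W p.1 - W p.2)) := by
        intro u
        rw [← Complex.mul_conj', hg]
        simp only [map_sum]
        rw [Finset.sum_mul_sum, Finset.sum_product]
        refine Finset.sum_congr rfl fun i _ => Finset.sum_congr rfl fun j _ => ?_
        rw [dotP_sub_right, sub_eq_add_neg, AddChar.map_add_eq_mul, AddChar.map_neg_eq_conj]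
      simp only [e]
      rw [Finset.sum_comm]
      simp only [sum_addChar_dotP hχ, sub_eq_zero, ← Finset.sum_filter]
      rw [Finset.sum_const, nsmul_eq_mul, mul_comm]
      rfl
    exact_mod_cast this
  have h3 : (∑ u, (#{i ∈ I | U i = u} : ℝ) ^ 2) = #(coincidences I U) := by
    exact_mod_cast sum_card_fiber_sq I U univ (fun _ _ => mem_univ _)
  calc ‖∑ i ∈ I, ∑ j ∈ J, χ (dotP (U i) (W j))‖ ^ 2
      = ‖∑ u, (#{i ∈ I | U i = u} : ℂ) * g u‖ ^ 2 := by rw [← h1]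
    _ ≤ (∑ u, (#{i ∈ I | U i = u} : ℝ) * ‖g u‖) ^ 2 := by
        gcongr
        refine (norm_sum_le _ _).trans_eq ?_
        simp
    _ ≤ (∑ u, (#{i ∈ I | U i = u} : ℝ) ^ 2) * ∑ u, ‖g u‖ ^ 2 :=
        Finset.sum_mul_sq_le_sq_mul_sq _ _ _
    _ = _ := by rw [h2, h3]; ring

end CharacterSums

section Incidences

variable {F : Type*} [Field F] [Fintype F] [DecidableEq F] {n : ℕ} {ι κ : Type*}

/-- The pairs of indices in `S` whose vectors are proportional. -/
def parallelPairs (S : Finset ι) (X : ι → Fin n → F) : Finset (ι × ι) :=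
  (S ×ˢ S).filter fun p => ∃ c : F, c ≠ 0 ∧ X p.1 = c • X p.2

/-- The pairs of indices in `S ×ˢ T` whose vectors are orthogonal. -/
def orthogonalPairs (S : Finset ι) (T : Finset κ) (X : ι → Fin n → F) (Y : κ → Fin n → F) :
    Finset (ι × κ) :=
  (S ×ˢ T).filter fun p => dotP (X p.1) (Y p.2) = 0

theorem card_parallelPairs_of_injOn (S : Finset ι) (X : ι → Fin n → F)
    (h : ∀ s ∈ S, ∀ t ∈ S, ∀ c : F, c ≠ 0 → X s = c • X t → s = t) :
    #(parallelPairs S X) ≤ #S := by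
  refine Finset.card_le_card_of_injOn Prod.fst ?_ ?_
  · rintro ⟨s, t⟩ hp
    simp only [parallelPairs, coe_filter, mem_product, Set.mem_ofPred_eq] at hp
    exact hp.1.1
  · rintro ⟨s, t⟩ hp ⟨s', t'⟩ hp' heq
    simp only [parallelPairs, coe_filter, mem_product, Set.mem_ofPred_eq] at hp hp' heq
    obtain ⟨⟨h1, h2⟩, c, hc, hX⟩ := hp
    obtain ⟨⟨h1', h2'⟩, c', hc', hX'⟩ := hp'
    have e := h s h1 t h2 c hc hX
    have e' := h s' h1' t' h2' c' hc' hX'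
    simp [← e, ← e', heq]

theorem card_coincidences_smul_le (S : Finset ι) (X : ι → Fin n → F) (hX : ∀ s ∈ S, X s ≠ 0) :
    #(coincidences ((univ : Finset Fˣ) ×ˢ S) fun p => (p.1 : F) • X p.2) ≤
      (Fintype.card F - 1) * #(parallelPairs S X) := by
  rw [← Fintype.card_units, ← Finset.card_univ, ← Finset.card_product]
  refine Finset.card_le_card_of_injOn (fun p => (p.1.1, (p.1.2, p.2.2))) ?_ ?_
  · rintro ⟨⟨a, s⟩, ⟨b, t⟩⟩ hp
    simp only [coincidences, coe_filter, mem_product, mem_univ, true_and,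
      Set.mem_ofPred_eq] at hp
    simp only [parallelPairs, coe_product, Set.mem_prod, coe_univ, Set.mem_univ, true_and,
      coe_filter, mem_product, Set.mem_ofPred_eq]
    refine ⟨hp.1, (a : F)⁻¹ * b, mul_ne_zero (inv_ne_zero a.ne_zero) b.ne_zero, ?_⟩
    rw [mul_smul, ← hp.2, smul_smul, inv_mul_cancel₀ a.ne_zero, one_smul]
  · rintro ⟨⟨a, s⟩, ⟨b, t⟩⟩ hp ⟨⟨a', s'⟩, ⟨b', t'⟩⟩ hp' heq
    simp only [coincidences, coe_filter, mem_product, mem_univ, true_and,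
      Set.mem_ofPred_eq] at hp hp'
    simp only [Prod.mk.injEq] at heq
    obtain ⟨rfl, rfl, rfl⟩ := heq
    have hb : (b : F) = b' := smul_left_injective F (hX t hp.1.2) (hp.2.symm.trans hp'.2)
    rw [Units.ext hb]

theorem sum_units_mul {χ : AddChar F ℂ} (hχ : χ ≠ 0) (x : F) :
    ∑ a : Fˣ, χ (a * x) = if x = 0 then (Fintype.card F : ℂ) - 1 else -1 := by
  split_ifs with hx
  · simp [hx, Fintype.card_units, Nat.cast_sub Fintype.card_pos]
  · have h1 : ∑ a : F, χ (a * x) = 0 := by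
      have : ∑ a : F, χ (a * x) = ∑ a : F, χ a :=
        Fintype.sum_equiv (Equiv.mulRight₀ x hx) _ _ fun _ => rfl
      classical
      rw [this, AddChar.sum_eq_ite, if_neg hχ]
    have h2 : ∑ a : Fˣ, χ (a * x) = ∑ a ∈ univ.erase (0 : F), χ (a * x) := by
      refine Finset.sum_bij (fun a _ => (a : F)) ?_ ?_ ?_ ?_
      · simp
      · intro a _ b _ h
        exact Units.ext h
      · intro b hb
        exact ⟨Units.mk0 b (Finset.ne_of_mem_erase hb), mem_univ _, rfl⟩
      · simp
    have h3 := Finset.sum_erase_add univ (fun a : F => χ (a * x)) (mem_univ 0)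
    rw [h1, ← h2] at h3
    simp only [zero_mul, AddChar.map_zero_eq_one] at h3
    exact eq_neg_of_add_eq_zero_left h3

/-- The finite field incidence bound, in terms of the number of proportional pairs. -/
theorem orthogonalPairs_discrepancy (S : Finset ι) (T : Finset κ) (X : ι → Fin n → F)
    (Y : κ → Fin n → F) (hX : ∀ s ∈ S, X s ≠ 0) (hY : ∀ t ∈ T, Y t ≠ 0) :
    ((Fintype.card F : ℝ) * #(orthogonalPairs S T X Y) - #S * #T) ^ 2 ≤
      (Fintype.card F : ℝ) ^ n * #(parallelPairs S X) * #(parallelPairs T Y) := by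
  obtain ⟨χ, hχ1⟩ := AddChar.exists_apply_ne_zero.mpr (one_ne_zero (α := F))
  have hχ : χ ≠ 0 := by rintro rfl; simp at hχ1
  set q := Fintype.card F with hq
  have hq1 : (1 : ℝ) < q := by exact_mod_cast Fintype.one_lt_card
  have key := norm_sq_sum_addChar_dotP_le hχ ((univ : Finset Fˣ) ×ˢ S) ((univ : Finset Fˣ) ×ˢ T)
    (fun p => (p.1 : F) • X p.2) (fun p => (p.1 : F) • Y p.2)
  have hsum : ∑ i ∈ (univ : Finset Fˣ) ×ˢ S, ∑ j ∈ (univ : Finset Fˣ) ×ˢ T,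
      χ (dotP ((i.1 : F) • X i.2) ((j.1 : F) • Y j.2)) =
      (((q : ℝ) - 1) * (q * #(orthogonalPairs S T X Y) - #S * #T) : ℝ) := by
    have h1 : ∑ i ∈ (univ : Finset Fˣ) ×ˢ S, ∑ j ∈ (univ : Finset Fˣ) ×ˢ T,
        χ (dotP ((i.1 : F) • X i.2) ((j.1 : F) • Y j.2)) =
        ∑ b : Fˣ, ∑ s ∈ S, ∑ t ∈ T, ∑ a : Fˣ, χ (a * (b * dotP (X s) (Y t))) := by
      simp only [Finset.sum_product, dotP_smul_smul]
      rw [Finset.sum_congr rfl fun a _ => Finset.sum_comm, Finset.sum_comm]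
      refine Finset.sum_congr rfl fun b _ => ?_
      rw [Finset.sum_comm]
      exact Finset.sum_congr rfl fun s _ => Finset.sum_comm
    have h2 : ∀ (b : Fˣ) (s : ι) (t : κ), ∑ a : Fˣ, χ (a * (b * dotP (X s) (Y t))) =
        (if dotP (X s) (Y t) = 0 then (q : ℂ) else 0) - 1 := by
      intro b s t
      rw [sum_units_mul hχ]
      simp only [mul_eq_zero, b.ne_zero, false_or]
      split_ifs <;> ring
    have h3 : ∑ s ∈ S, ∑ t ∈ T, ((if dotP (X s) (Y t) = 0 then (q : ℂ) else 0) - 1) =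
        q * #(orthogonalPairs S T X Y) - #S * #T := by
      rw [← Finset.sum_product', Finset.sum_sub_distrib, ← Finset.sum_filter]
      simp only [sum_const, nsmul_eq_mul, card_product, orthogonalPairs]
      push_cast
      ring
    rw [h1]
    simp only [h2, h3, sum_const, card_univ, Fintype.card_units, nsmul_eq_mul]
    rw [Nat.cast_sub Fintype.card_pos]
    push_cast
    rfl
  rw [hsum, Complex.norm_real, Real.norm_eq_abs, sq_abs, mul_pow] at key
  have hcast : ((q - 1 : ℕ) : ℝ) = q - 1 := by
    rw [Nat.cast_sub Fintype.card_pos]; simp [hq]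
  have hU : (#(coincidences ((univ : Finset Fˣ) ×ˢ S) fun p => (p.1 : F) • X p.2) : ℝ) ≤
      (q - 1) * #(parallelPairs S X) := by
    rw [← hcast]; exact_mod_cast card_coincidences_smul_le S X hX
  have hW : (#(coincidences ((univ : Finset Fˣ) ×ˢ T) fun p => (p.1 : F) • Y p.2) : ℝ) ≤
      (q - 1) * #(parallelPairs T Y) := by
    rw [← hcast]; exact_mod_cast card_coincidences_smul_le T Y hY
  have hpos : (0 : ℝ) < (q - 1) ^ 2 := by have := sub_pos.mpr hq1; positivity
  refine le_of_mul_le_mul_left ?_ hpos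
  calc _ ≤ _ := key
    _ ≤ (q : ℝ) ^ n * ((q - 1) * #(parallelPairs S X)) * ((q - 1) * #(parallelPairs T Y)) := by
        have := sub_pos.mpr hq1
        gcongr
    _ = _ := by ring

end Incidences

section Reflections

variable {F : Type*} [Field F]

/-- The squared distance between the projections of two points to the first two coordinates. -/
def planeSqDist (x y : Fin 3 → F) : F := (x 0 - y 0) ^ 2 + (x 1 - y 1) ^ 2

theorem exists_half_rotation {e₀ e₁ x₀ x₁ : F} (he : e₀ ^ 2 + e₁ ^ 2 ≠ 0)
    (hx : x₀ ^ 2 + x₁ ^ 2 = e₀ ^ 2 + e₁ ^ 2) :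
    ∃ v : F × F, v ≠ 0 ∧ x₀ * v.1 + x₁ * v.2 = e₀ * v.1 - e₁ * v.2 ∧
      x₁ * v.1 - x₀ * v.2 = e₀ * v.2 + e₁ * v.1 := by
  by_cases h : e₀ ^ 2 + e₁ ^ 2 + x₀ * e₀ + x₁ * e₁ = 0 ∧ x₁ * e₀ - x₀ * e₁ = 0
  · obtain ⟨h1, h2⟩ := h
    have k0 : x₀ = -e₀ := by
      apply mul_right_cancel₀ he
      linear_combination e₀ * h1 - e₁ * h2
    have k1 : x₁ = -e₁ := by
      apply mul_right_cancel₀ he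
      linear_combination e₁ * h1 + e₀ * h2
    exact ⟨(0, 1), by simp, by simp [k1], by simp [k0]⟩
  · refine ⟨(e₀ ^ 2 + e₁ ^ 2 + x₀ * e₀ + x₁ * e₁, x₁ * e₀ - x₀ * e₁), ?_, ?_, ?_⟩
    · simpa [Prod.ext_iff] using h
    · linear_combination e₀ * hx
    · linear_combination e₁ * hx

theorem reflection_bilinear_relation (aniso : ∀ x y : F, x ^ 2 + y ^ 2 = 0 → x = 0 ∧ y = 0)
    (h2 : (2 : F) ≠ 0) {e₀ e₁ x₀ x₁ y₀ y₁ m₀ m₁ k : F} {v w : F × F}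
    (hx : x₀ ^ 2 + x₁ ^ 2 ≠ 0) (hv : v ≠ 0) (hw : w ≠ 0)
    (hxv : x₀ * v.1 + x₁ * v.2 = e₀ * v.1 - e₁ * v.2)
    (hxv' : x₁ * v.1 - x₀ * v.2 = e₀ * v.2 + e₁ * v.1)
    (hyw : y₀ * w.1 + y₁ * w.2 = e₀ * w.1 - e₁ * w.2)
    (hyw' : y₁ * w.1 - y₀ * w.2 = e₀ * w.2 + e₁ * w.1)
    (hm : m₀ * (x₀ + y₀) + m₁ * (x₁ + y₁) = 0)
    (hk₀ : y₀ - x₀ = k * m₀) (hk₁ : y₁ - x₁ = k * m₁) :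
    e₀ * (m₀ * (v.1 * w.1 - v.2 * w.2) + m₁ * (v.1 * w.2 + v.2 * w.1)) +
      e₁ * (m₁ * (v.1 * w.1 - v.2 * w.2) - m₀ * (v.1 * w.2 + v.2 * w.1)) = 0 := by
  obtain ⟨v₀, v₁⟩ := v
  obtain ⟨w₀, w₁⟩ := w
  simp only at *
  have s0 : (x₀ + y₀) * (v₀ * w₀ - v₁ * w₁) + (x₁ + y₁) * (v₀ * w₁ + v₁ * w₀) =
      2 * (v₀ * w₀ + v₁ * w₁) * e₀ := by
    linear_combination w₀ * hxv + w₁ * hxv' + v₀ * hyw + v₁ * hyw'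
  have s1 : (x₁ + y₁) * (v₀ * w₀ - v₁ * w₁) - (x₀ + y₀) * (v₀ * w₁ + v₁ * w₀) =
      2 * (v₀ * w₀ + v₁ * w₁) * e₁ := by
    linear_combination w₀ * hxv' - w₁ * hxv + v₀ * hyw' - v₁ * hyw
  by_cases hr : v₀ * w₀ + v₁ * w₁ = 0
  · have hV : v₀ ^ 2 + v₁ ^ 2 ≠ 0 := fun h => hv (by simpa [Prod.ext_iff] using aniso _ _ h)
    have hW : w₀ ^ 2 + w₁ ^ 2 ≠ 0 := fun h => hw (by simpa [Prod.ext_iff] using aniso _ _ h)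
    have hVW := mul_ne_zero hV hW
    rw [hr] at s0 s1
    have t0 : x₀ + y₀ = 0 := by
      apply (mul_eq_zero_iff_right hVW).mp
      linear_combination (v₀ * w₀ - v₁ * w₁) * s0 - (v₀ * w₁ + v₁ * w₀) * s1
    have t1 : x₁ + y₁ = 0 := by
      apply (mul_eq_zero_iff_right hVW).mp
      linear_combination (v₀ * w₁ + v₁ * w₀) * s0 + (v₀ * w₀ - v₁ * w₁) * s1
    have u0 : k * m₀ = -2 * x₀ := by linear_combination t0 - hk₀
    have u1 : k * m₁ = -2 * x₁ := by linear_combination t1 - hk₁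
    have hk : k ≠ 0 := by
      rintro rfl
      have z0 : x₀ = 0 := by simpa [h2] using u0
      have z1 : x₁ = 0 := by simpa [h2] using u1
      exact hx (by rw [z0, z1]; ring)
    apply (mul_eq_zero_iff_left hk).mp
    linear_combination (e₀ * (v₀ * w₀ - v₁ * w₁) - e₁ * (v₀ * w₁ + v₁ * w₀)) * u0 +
      (e₀ * (v₀ * w₁ + v₁ * w₀) + e₁ * (v₀ * w₀ - v₁ * w₁)) * u1
      - 2 * (e₀ * w₀ - e₁ * w₁) * hxv - 2 * (e₀ * w₁ + e₁ * w₀) * hxv'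
      - 2 * (e₀ ^ 2 + e₁ ^ 2) * hr
  · apply (mul_eq_zero_iff_left (mul_ne_zero h2 hr)).mp
    linear_combination ((v₀ * w₀ - v₁ * w₁) ^ 2 + (v₀ * w₁ + v₁ * w₀) ^ 2) * hm -
      (m₀ * (v₀ * w₀ - v₁ * w₁) + m₁ * (v₀ * w₁ + v₁ * w₀)) * s0 -
      (m₁ * (v₀ * w₀ - v₁ * w₁) - m₀ * (v₀ * w₁ + v₁ * w₀)) * s1

end Reflections

theorem eq_of_paraboloid {F : Type*} [Field F] {E : Finset (Fin 3 → F)}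
    (hE : ∀ x ∈ E, x 2 = x 0 ^ 2 + x 1 ^ 2)
    {x y : Fin 3 → F} (hx : x ∈ E) (hy : y ∈ E) (h0 : x 0 = y 0) (h1 : x 1 = y 1) : x = y := by
  funext i
  fin_cases i
  · exact h0
  · exact h1
  · change x 2 = y 2
    rw [hE x hx, hE y hy, h0, h1]

theorem le_of_discrepancy {q z s a b : ℝ} (hs : 0 ≤ s) (hb : 0 ≤ b) (has : a ≤ s)
    (hbs : b ≤ s) (h : (q * z - s * s) ^ 2 ≤ q ^ 4 * a * b) : q * z ≤ s ^ 2 + q ^ 2 * s := by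
  have hsq : (q * z - s * s) ^ 2 ≤ (q ^ 2 * s) ^ 2 :=
    calc _ ≤ _ := h
      _ ≤ q ^ 4 * s * s := by gcongr
      _ = _ := by ring
  linarith [(abs_le_of_sq_le_sq' hsq (by positivity)).2]

section BisectorEnergy

variable {F : Type*} [Field F] [Fintype F] [DecidableEq F]

/-- The pairs of points of `E` at planar squared distance `d`. -/
def pairsAtDist (E : Finset (Fin 3 → F)) (d : F) : Finset ((Fin 3 → F) × (Fin 3 → F)) :=
  (E ×ˢ E).filter fun p => planeSqDist p.1 p.2 = d

/-- The pairs of nondegenerate chords of `E` with parallel directions. For a subset of the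
paraboloid these are the pairs of chords whose projections have the same perpendicular bisector. -/
def parallelChords (E : Finset (Fin 3 → F)) :
    Finset (((Fin 3 → F) × (Fin 3 → F)) × ((Fin 3 → F) × (Fin 3 → F))) :=
  parallelPairs E.offDiag fun p => p.1 - p.2

theorem parallelChords_relations {E : Finset (Fin 3 → F)}
    (hE : ∀ x ∈ E, x 2 = x 0 ^ 2 + x 1 ^ 2) {a a' b b' : Fin 3 → F}
    (h : ((a, a'), (b, b')) ∈ parallelChords E) :
    (a ∈ E ∧ a' ∈ E ∧ b ∈ E ∧ b' ∈ E) ∧ a ≠ a' ∧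
    (a 0 - a' 0) * ((a 0 - b 0) + (a' 0 - b' 0)) +
      (a 1 - a' 1) * ((a 1 - b 1) + (a' 1 - b' 1)) = 0 ∧
    ∃ k : F, (a' 0 - b' 0) - (a 0 - b 0) = k * (a 0 - a' 0) ∧
      (a' 1 - b' 1) - (a 1 - b 1) = k * (a 1 - a' 1) := by
  simp only [parallelChords, parallelPairs, mem_filter, mem_product, mem_offDiag] at h
  obtain ⟨⟨⟨ha, ha', hne⟩, hb, hb', -⟩, c, hc, heq⟩ := h
  have h0 : a 0 - a' 0 = c * (b 0 - b' 0) := congrFun heq 0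
  have h1 : a 1 - a' 1 = c * (b 1 - b' 1) := congrFun heq 1
  have h2 : a 2 - a' 2 = c * (b 2 - b' 2) := congrFun heq 2
  rw [hE a ha, hE a' ha', hE b hb, hE b' hb'] at h2
  refine ⟨⟨ha, ha', hb, hb'⟩, hne, ?_, c⁻¹ - 1, ?_, ?_⟩
  · linear_combination h2 - (b 0 + b' 0) * h0 - (b 1 + b' 1) * h1
  · rw [h0]; field_simp; linear_combination -h0
  · rw [h1]; field_simp; linear_combination -h1

theorem parallelChords_sqDist {E : Finset (Fin 3 → F)}
    (hE : ∀ x ∈ E, x 2 = x 0 ^ 2 + x 1 ^ 2) {a a' b b' : Fin 3 → F}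
    (h : ((a, a'), (b, b')) ∈ parallelChords E) : planeSqDist a' b' = planeSqDist a b := by
  obtain ⟨-, -, hm, k, hk0, hk1⟩ := parallelChords_relations hE h
  simp only [planeSqDist]
  linear_combination (a' 0 - b' 0 + (a 0 - b 0)) * hk0 + (a' 1 - b' 1 + (a 1 - b 1)) * hk1 +
    k * hm

theorem card_parallelChords_dist_zero (aniso : ∀ x y : F, x ^ 2 + y ^ 2 = 0 → x = 0 ∧ y = 0)
    {E : Finset (Fin 3 → F)} (hE : ∀ x ∈ E, x 2 = x 0 ^ 2 + x 1 ^ 2) :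
    #{p ∈ parallelChords E | planeSqDist p.1.1 p.2.1 = 0} ≤ #E ^ 2 := by
  have key : ∀ a a' b b' : Fin 3 → F, ((a, a'), (b, b')) ∈ parallelChords E →
      planeSqDist a b = 0 → a = b ∧ a' = b' := by
    intro a a' b b' h hd
    obtain ⟨⟨ha, ha', hb, hb'⟩, -⟩ := parallelChords_relations hE h
    have hd' := (parallelChords_sqDist hE h).trans hd
    obtain ⟨e0, e1⟩ := aniso _ _ hd
    obtain ⟨e0', e1'⟩ := aniso _ _ hd'
    exact ⟨eq_of_paraboloid hE ha hb (sub_eq_zero.mp e0) (sub_eq_zero.mp e1),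
      eq_of_paraboloid hE ha' hb' (sub_eq_zero.mp e0') (sub_eq_zero.mp e1')⟩
  rw [sq, ← Finset.card_product]
  refine Finset.card_le_card_of_injOn Prod.fst ?_ ?_
  · rintro ⟨⟨a, a'⟩, ⟨b, b'⟩⟩ hp
    obtain ⟨hp, hd⟩ := mem_filter.mp (mem_coe.mp hp)
    obtain ⟨⟨ha, ha', -⟩, -⟩ := parallelChords_relations hE hp
    exact mem_coe.mpr (mem_product.mpr ⟨ha, ha'⟩)
  · rintro ⟨⟨a, a'⟩, ⟨b, b'⟩⟩ hp ⟨⟨c, c'⟩, ⟨d, d'⟩⟩ hp' heq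
    obtain ⟨hp, hd⟩ := mem_filter.mp (mem_coe.mp hp)
    obtain ⟨hp', hd'⟩ := mem_filter.mp (mem_coe.mp hp')
    obtain ⟨rfl, rfl⟩ := key _ _ _ _ hp hd
    obtain ⟨rfl, rfl⟩ := key _ _ _ _ hp' hd'
    exact Prod.ext heq heq

/-- The kinematic mapping: congruent pairs of points that are mirror images of each other correspond
to orthogonal pairs of vectors in four dimensions. -/
theorem exists_kinematic_mapping
    (aniso : ∀ x y : F, x ^ 2 + y ^ 2 = 0 → x = 0 ∧ y = 0) (h2 : (2 : F) ≠ 0)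
    {E : Finset (Fin 3 → F)} (hE : ∀ x ∈ E, x 2 = x 0 ^ 2 + x 1 ^ 2) {d : F} (hd : d ≠ 0)
    {e₀ e₁ : F} (he : e₀ ^ 2 + e₁ ^ 2 = d) :
    ∃ X Y : (Fin 3 → F) × (Fin 3 → F) → Fin 4 → F,
      (∀ s ∈ pairsAtDist E d, X s ≠ 0) ∧ (∀ s ∈ pairsAtDist E d, Y s ≠ 0) ∧
      (∀ s ∈ pairsAtDist E d, ∀ t ∈ pairsAtDist E d, ∀ c : F, c ≠ 0 → X s = c • X t → s = t) ∧
      (∀ s ∈ pairsAtDist E d, ∀ t ∈ pairsAtDist E d, ∀ c : F, c ≠ 0 → Y s = c • Y t → s = t) ∧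
      ∀ a a' b b' : Fin 3 → F, ((a, a'), (b, b')) ∈ parallelChords E →
        (a, b) ∈ pairsAtDist E d → (a', b') ∈ pairsAtDist E d →
        dotP (X (a, b)) (Y (a', b')) = 0 := by
  set S := pairsAtDist E d with hS
  have memS : ∀ p ∈ S, (p.1 ∈ E ∧ p.2 ∈ E) ∧
      (p.1 0 - p.2 0) ^ 2 + (p.1 1 - p.2 1) ^ 2 = d := by
    intro p hp
    obtain ⟨h1, h2⟩ := mem_filter.mp hp
    exact ⟨mem_product.mp h1, h2⟩
  have hed : e₀ ^ 2 + e₁ ^ 2 ≠ 0 := he ▸ hd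
  have hv : ∀ p : (Fin 3 → F) × (Fin 3 → F), ∃ v : F × F, p ∈ S → v ≠ 0 ∧
      (p.1 0 - p.2 0) * v.1 + (p.1 1 - p.2 1) * v.2 = e₀ * v.1 - e₁ * v.2 ∧
      (p.1 1 - p.2 1) * v.1 - (p.1 0 - p.2 0) * v.2 = e₀ * v.2 + e₁ * v.1 := by
    intro p
    by_cases hp : p ∈ S
    · obtain ⟨v, hv⟩ := exists_half_rotation hed ((memS p hp).2.trans he.symm)
      exact ⟨v, fun _ => hv⟩
    · exact ⟨0, fun h => absurd h hp⟩
  choose v hv using hv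
  have hvn : ∀ p ∈ S, (v p).1 ^ 2 + (v p).2 ^ 2 ≠ 0 := fun p hp h =>
    (hv p hp).1 (Prod.ext (aniso _ _ h).1 (aniso _ _ h).2)
  let w : (Fin 3 → F) × (Fin 3 → F) → F × F := fun p =>
    (p.1 0 * (v p).1 + p.1 1 * (v p).2, p.1 1 * (v p).1 - p.1 0 * (v p).2)
  let X : (Fin 3 → F) × (Fin 3 → F) → Fin 4 → F := fun p => ![(w p).1, (w p).2, (v p).1, (v p).2]
  let Y : (Fin 3 → F) × (Fin 3 → F) → Fin 4 → F := fun p =>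
    ![-(e₀ * (v p).1) + e₁ * (v p).2, -(e₀ * (v p).2) - e₁ * (v p).1,
      e₀ * (w p).1 + e₁ * (w p).2, e₀ * (w p).2 - e₁ * (w p).1]
  have hXinj : ∀ s ∈ S, ∀ t ∈ S, ∀ c : F, c ≠ 0 → X s = c • X t → s = t := by
    intro s hs t ht c hc hst
    have x0 : (w s).1 = c * (w t).1 := congrFun hst 0
    have x1 : (w s).2 = c * (w t).2 := congrFun hst 1
    have x2 : (v s).1 = c * (v t).1 := congrFun hst 2
    have x3 : (v s).2 = c * (v t).2 := congrFun hst 3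
    simp only [w] at x0 x1
    obtain ⟨-, hs1, hs2⟩ := hv s hs
    obtain ⟨-, ht1, ht2⟩ := hv t ht
    have hn := hvn t ht
    rw [x2, x3] at x0 x1 hs1 hs2
    have hcn := mul_ne_zero hc hn
    have a0 : s.1 0 = t.1 0 := by
      apply mul_left_cancel₀ hcn
      linear_combination (v t).1 * x0 - (v t).2 * x1
    have a1 : s.1 1 = t.1 1 := by
      apply mul_left_cancel₀ hcn
      linear_combination (v t).2 * x0 + (v t).1 * x1
    have b0 : s.1 0 - s.2 0 = t.1 0 - t.2 0 := by
      apply mul_left_cancel₀ hcn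
      linear_combination (v t).1 * (hs1 - c * ht1) - (v t).2 * (hs2 - c * ht2)
    have b1 : s.1 1 - s.2 1 = t.1 1 - t.2 1 := by
      apply mul_left_cancel₀ hcn
      linear_combination (v t).2 * (hs1 - c * ht1) + (v t).1 * (hs2 - c * ht2)
    obtain ⟨⟨m1, m2⟩, -⟩ := memS s hs
    obtain ⟨⟨m1', m2'⟩, -⟩ := memS t ht
    exact Prod.ext (eq_of_paraboloid hE m1 m1' a0 a1)
      (eq_of_paraboloid hE m2 m2' (by linear_combination a0 - b0) (by linear_combination a1 - b1))
  have hX : ∀ s ∈ S, X s ≠ 0 := by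
    intro s hs h
    have x2 : (v s).1 = 0 := congrFun h 2
    have x3 : (v s).2 = 0 := congrFun h 3
    exact (hv s hs).1 (Prod.ext x2 x3)
  have hYX : ∀ s t (c : F), Y s = c • Y t → X s = c • X t := by
    intro s t c hst
    have y0 : -(e₀ * (v s).1) + e₁ * (v s).2 = c * (-(e₀ * (v t).1) + e₁ * (v t).2) :=
      congrFun hst 0
    have y1 : -(e₀ * (v s).2) - e₁ * (v s).1 = c * (-(e₀ * (v t).2) - e₁ * (v t).1) :=
      congrFun hst 1
    have y2 : e₀ * (w s).1 + e₁ * (w s).2 = c * (e₀ * (w t).1 + e₁ * (w t).2) := congrFun hst 2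
    have y3 : e₀ * (w s).2 - e₁ * (w s).1 = c * (e₀ * (w t).2 - e₁ * (w t).1) := congrFun hst 3
    funext i
    fin_cases i
    · change (w s).1 = c * (w t).1
      apply mul_left_cancel₀ hed
      linear_combination e₀ * y2 - e₁ * y3
    · change (w s).2 = c * (w t).2
      apply mul_left_cancel₀ hed
      linear_combination e₁ * y2 + e₀ * y3
    · change (v s).1 = c * (v t).1
      apply mul_left_cancel₀ hed
      linear_combination -e₀ * y0 - e₁ * y1
    · change (v s).2 = c * (v t).2
      apply mul_left_cancel₀ hed
      linear_combination e₁ * y0 - e₀ * y1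
  have hY : ∀ s ∈ S, Y s ≠ 0 := by
    intro s hs h
    have := hYX s s 0 (by rw [h, zero_smul])
    exact hX s hs (by rw [this, zero_smul])
  refine ⟨X, Y, hX, hY, hXinj, fun s hs t ht c hc h => hXinj s hs t ht c hc (hYX s t c h), ?_⟩
  intro a a' b b' hp hs ht
  obtain ⟨-, -, hm, k, hk0, hk1⟩ := parallelChords_relations hE hp
  obtain ⟨hvs, hs1, hs2⟩ := hv _ hs
  obtain ⟨hvt, ht1, ht2⟩ := hv _ ht
  have hne : (a 0 - b 0) ^ 2 + (a 1 - b 1) ^ 2 ≠ 0 := (memS _ hs).2 ▸ hd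
  have key := reflection_bilinear_relation aniso h2 hne hvs hvt hs1 hs2 ht1 ht2 hm hk0 hk1
  have hform : dotP (X (a, b)) (Y (a', b')) =
      (w (a, b)).1 * (-(e₀ * (v (a', b')).1) + e₁ * (v (a', b')).2) +
      (w (a, b)).2 * (-(e₀ * (v (a', b')).2) - e₁ * (v (a', b')).1) +
      (v (a, b)).1 * (e₀ * (w (a', b')).1 + e₁ * (w (a', b')).2) +
      (v (a, b)).2 * (e₀ * (w (a', b')).2 - e₁ * (w (a', b')).1) := Fin.sum_univ_four _
  rw [hform]
  simp only [w]
  linear_combination -key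

theorem card_parallelChords_dist_ne_zero
    (aniso : ∀ x y : F, x ^ 2 + y ^ 2 = 0 → x = 0 ∧ y = 0) (h2 : (2 : F) ≠ 0)
    {E : Finset (Fin 3 → F)} (hE : ∀ x ∈ E, x 2 = x 0 ^ 2 + x 1 ^ 2) {d : F} (hd : d ≠ 0) :
    (Fintype.card F : ℝ) * #{p ∈ parallelChords E | planeSqDist p.1.1 p.2.1 = d} ≤
      (#(pairsAtDist E d) : ℝ) ^ 2 + (Fintype.card F : ℝ) ^ 2 * #(pairsAtDist E d) := by
  set S := pairsAtDist E d with hS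
  rcases S.eq_empty_or_nonempty with hemp | ⟨p₀, hp₀⟩
  · have : #{p ∈ parallelChords E | planeSqDist p.1.1 p.2.1 = d} = 0 := by
      rw [Finset.card_eq_zero, Finset.filter_eq_empty_iff]
      rintro ⟨⟨a, a'⟩, ⟨b, b'⟩⟩ hp hpd
      obtain ⟨⟨ha, -, hb, -⟩, -⟩ := parallelChords_relations hE hp
      have : (a, b) ∈ S := by simpa [hS, pairsAtDist] using ⟨⟨ha, hb⟩, hpd⟩
      simp [hemp] at this
    rw [this]
    simp only [Nat.cast_zero, mul_zero]
    positivity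
  obtain ⟨X, Y, hX, hY, hXinj, hYinj, horth⟩ :=
    exists_kinematic_mapping aniso h2 hE hd (mem_filter.mp hp₀).2
  have hle : #{p ∈ parallelChords E | planeSqDist p.1.1 p.2.1 = d} ≤
      #(orthogonalPairs S S X Y) := by
    refine Finset.card_le_card_of_injOn (fun p => ((p.1.1, p.2.1), (p.1.2, p.2.2))) ?_ ?_
    · rintro ⟨⟨a, a'⟩, ⟨b, b'⟩⟩ hp
      obtain ⟨hp, hpd⟩ := mem_filter.mp (mem_coe.mp hp)
      obtain ⟨⟨ha, ha', hb, hb'⟩, -⟩ := parallelChords_relations hE hp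
      have hs : (a, b) ∈ S := mem_filter.mpr ⟨mem_product.mpr ⟨ha, hb⟩, hpd⟩
      have ht : (a', b') ∈ S := mem_filter.mpr
        ⟨mem_product.mpr ⟨ha', hb'⟩, (parallelChords_sqDist hE hp).trans hpd⟩
      exact mem_coe.mpr (mem_filter.mpr ⟨mem_product.mpr ⟨hs, ht⟩, horth a a' b b' hp hs ht⟩)
    · rintro ⟨⟨a, a'⟩, ⟨b, b'⟩⟩ - ⟨⟨c, c'⟩, ⟨d, d'⟩⟩ - heq
      simp only [Prod.mk.injEq] at heq ⊢
      tauto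
  have hdisc := orthogonalPairs_discrepancy S S X Y hX hY
  have hPX : (#(parallelPairs S X) : ℝ) ≤ #S := by
    exact_mod_cast card_parallelPairs_of_injOn S X hXinj
  have hPY : (#(parallelPairs S Y) : ℝ) ≤ #S := by
    exact_mod_cast card_parallelPairs_of_injOn S Y hYinj
  have hle' : (#{p ∈ parallelChords E | planeSqDist p.1.1 p.2.1 = d} : ℝ) ≤
      #(orthogonalPairs S S X Y) := by exact_mod_cast hle
  refine (mul_le_mul_of_nonneg_left hle' (Nat.cast_nonneg _)).trans ?_
  exact le_of_discrepancy (Nat.cast_nonneg _) (Nat.cast_nonneg _) hPX hPY hdisc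

theorem card_parallelChords_le (aniso : ∀ x y : F, x ^ 2 + y ^ 2 = 0 → x = 0 ∧ y = 0)
    (h2 : (2 : F) ≠ 0) {E : Finset (Fin 3 → F)} (hE : ∀ x ∈ E, x 2 = x 0 ^ 2 + x 1 ^ 2) :
    (Fintype.card F : ℝ) * #(parallelChords E) ≤ Fintype.card F * (#E : ℝ) ^ 2 +
      (∑ d, (#(pairsAtDist E d) : ℝ) ^ 2 + (Fintype.card F : ℝ) ^ 2 * (#E : ℝ) ^ 2) := by
  set q := Fintype.card F
  have hfib : (#(parallelChords E) : ℝ) =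
      ∑ d, (#{p ∈ parallelChords E | planeSqDist p.1.1 p.2.1 = d} : ℝ) := by
    exact_mod_cast Finset.card_eq_sum_card_fiberwise
      (f := fun p : ((Fin 3 → F) × (Fin 3 → F)) × ((Fin 3 → F) × (Fin 3 → F)) =>
        planeSqDist p.1.1 p.2.1) (t := univ) (fun _ _ => by simp)
  have hpairs : (∑ d, (#(pairsAtDist E d) : ℝ)) = (#E : ℝ) ^ 2 := by
    have := Finset.card_eq_sum_card_fiberwise (s := E ×ˢ E)
      (f := fun p : (Fin 3 → F) × (Fin 3 → F) => planeSqDist p.1 p.2) (t := univ)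
      (fun _ _ => by simp)
    rw [card_product, ← sq] at this
    exact_mod_cast this.symm
  have hterm : ∀ d : F, (q : ℝ) * #{p ∈ parallelChords E | planeSqDist p.1.1 p.2.1 = d} ≤
      (if d = 0 then (q : ℝ) * (#E : ℝ) ^ 2 else 0) +
      ((#(pairsAtDist E d) : ℝ) ^ 2 + (q : ℝ) ^ 2 * #(pairsAtDist E d)) := by
    intro d
    split_ifs with hd
    · subst hd
      have : (#{p ∈ parallelChords E | planeSqDist p.1.1 p.2.1 = 0} : ℝ) ≤ (#E : ℝ) ^ 2 := by
        exact_mod_cast card_parallelChords_dist_zero aniso hE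
      calc _ ≤ (q : ℝ) * (#E : ℝ) ^ 2 := by gcongr
        _ ≤ _ := le_add_of_nonneg_right (by positivity)
    · rw [zero_add]
      exact card_parallelChords_dist_ne_zero aniso h2 hE hd
  calc (q : ℝ) * #(parallelChords E)
      = ∑ d, (q : ℝ) * #{p ∈ parallelChords E | planeSqDist p.1.1 p.2.1 = d} := by
        rw [hfib, Finset.mul_sum]
    _ ≤ _ := Finset.sum_le_sum fun d _ => hterm d
    _ = _ := by
        rw [Finset.sum_add_distrib, Finset.sum_add_distrib, ← Finset.mul_sum, hpairs]
        simp

end BisectorEnergy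

theorem card_coincidences_dotP_eq {F : Type*} [Field F] [DecidableEq F]
    (E : Finset (Fin 3 → F)) (u : Fin 3 → F) :
    #(coincidences E (dotP u)) = #E + #{p ∈ E.offDiag | dotP u (p.1 - p.2) = 0} := by
  classical
  have hd : coincidences E (dotP u) =
      E.diag ∪ {p ∈ E.offDiag | dotP u (p.1 - p.2) = 0} := by
    ext ⟨x, y⟩
    simp only [coincidences, mem_filter, mem_product, mem_union, mem_diag, mem_offDiag,
      dotP_sub_right, sub_eq_zero]
    grind
  rw [hd, Finset.card_union_of_disjoint, Finset.diag_card]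
  exact (Finset.disjoint_diag_offDiag E).mono_right (Finset.filter_subset _ _)

section IsoscelesTriangles

variable {F : Type*} [Field F] [Fintype F] [DecidableEq F] {κ : Type*}

/-- The number of pairs of points of `E` with equal dot products against a family of vectors is
controlled by the number of parallel chords of `E`. -/
theorem sum_card_coincidences_dotP_le (E : Finset (Fin 3 → F)) (T : Finset κ)
    (X : κ → Fin 3 → F) (hX : ∀ t ∈ T, X t ≠ 0)
    (hinj : ∀ s ∈ T, ∀ t ∈ T, ∀ c : F, c ≠ 0 → X s = c • X t → s = t) :
    (Fintype.card F : ℝ) * ∑ t ∈ T, (#(coincidences E (dotP (X t))) : ℝ) ≤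
      Fintype.card F * #T * #E + #T * (#E : ℝ) ^ 2 +
        √((Fintype.card F : ℝ) ^ 3 * #T * #(parallelChords E)) := by
  set q := Fintype.card F
  let Y : (Fin 3 → F) × (Fin 3 → F) → Fin 3 → F := fun p => p.1 - p.2
  have hsum : ∑ t ∈ T, (#(coincidences E (dotP (X t))) : ℝ) =
      #T * #E + #(orthogonalPairs T E.offDiag X Y) := by
    have : #(orthogonalPairs T E.offDiag X Y) =
        ∑ t ∈ T, #{p ∈ E.offDiag | dotP (X t) (p.1 - p.2) = 0} := by
      simp only [orthogonalPairs, Finset.card_filter, Finset.sum_product]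
      rfl
    simp only [card_coincidences_dotP_eq, this]
    push_cast
    rw [Finset.sum_add_distrib, sum_const, nsmul_eq_mul]
  have hdisc := orthogonalPairs_discrepancy T E.offDiag X Y hX
    fun p hp => sub_ne_zero.mpr (mem_offDiag.mp hp).2.2
  have hP : (#(parallelPairs T X) : ℝ) ≤ #T := by
    exact_mod_cast card_parallelPairs_of_injOn T X hinj
  have hroot : (q : ℝ) * #(orthogonalPairs T E.offDiag X Y) - #T * #E.offDiag ≤
      √((q : ℝ) ^ 3 * #T * #(parallelChords E)) := by
    refine Real.le_sqrt_of_sq_le (hdisc.trans ?_)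
    change (q : ℝ) ^ 3 * #(parallelPairs T X) * #(parallelChords E) ≤ _
    gcongr
  have hoff : (#E.offDiag : ℝ) ≤ (#E : ℝ) ^ 2 := by
    have : #E.offDiag ≤ #E ^ 2 := by
      rw [offDiag_card, sq]
      exact Nat.sub_le _ _
    exact_mod_cast this
  have : (#T : ℝ) * #E.offDiag ≤ #T * (#E : ℝ) ^ 2 := by gcongr
  rw [hsum]
  linarith

theorem sum_card_pairsAtDist_sq_le {E : Finset (Fin 3 → F)}
    (hE : ∀ x ∈ E, x 2 = x 0 ^ 2 + x 1 ^ 2) :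
    ∑ d, (#(pairsAtDist E d) : ℝ) ^ 2 ≤
      #E * ∑ c ∈ E, (#(coincidences E (dotP ![-2 * c 0, -2 * c 1, 1])) : ℝ) := by
  have hcoin : ∀ c ∈ E, coincidences E (dotP ![-2 * c 0, -2 * c 1, 1]) =
      coincidences E (planeSqDist c) := by
    intro c hc
    have hdist : ∀ x ∈ E, planeSqDist c x = c 2 + dotP ![-2 * c 0, -2 * c 1, 1] x := by
      intro x hx
      simp only [planeSqDist, dotP, Fin.sum_univ_three, Matrix.cons_val]
      rw [hE x hx, hE c hc]
      ring
    refine Finset.filter_congr fun p hp => ?_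
    obtain ⟨h1, h2⟩ := mem_product.mp hp
    rw [hdist _ h1, hdist _ h2, add_right_inj]
  have hfib : ∀ d, #(pairsAtDist E d) = ∑ c ∈ E, #{x ∈ E | planeSqDist c x = d} := by
    intro d
    simp only [pairsAtDist, Finset.card_filter, Finset.sum_product]
  have hnat : ∑ d, #(pairsAtDist E d) ^ 2 ≤ #E * ∑ c ∈ E, #(coincidences E (planeSqDist c)) := by
    calc ∑ d, #(pairsAtDist E d) ^ 2
        ≤ ∑ d, #E * ∑ c ∈ E, #{x ∈ E | planeSqDist c x = d} ^ 2 := by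
          refine Finset.sum_le_sum fun d _ => ?_
          rw [hfib]
          exact sq_sum_le_card_mul_sum_sq
      _ = #E * ∑ c ∈ E, ∑ d, #{x ∈ E | planeSqDist c x = d} ^ 2 := by
          rw [← Finset.mul_sum, Finset.sum_comm]
      _ = _ := by
          congr 1
          exact Finset.sum_congr rfl fun c _ =>
            sum_card_fiber_sq E (planeSqDist c) univ fun _ _ => mem_univ _
  have hcongr : ∑ c ∈ E, #(coincidences E (dotP ![-2 * c 0, -2 * c 1, 1])) =
      ∑ c ∈ E, #(coincidences E (planeSqDist c)) :=
    Finset.sum_congr rfl fun c hc => by rw [hcoin c hc]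
  rw [← hcongr] at hnat
  rw [← Nat.cast_sum]
  exact_mod_cast hnat

theorem card_parallelChords_le_of_large (aniso : ∀ x y : F, x ^ 2 + y ^ 2 = 0 → x = 0 ∧ y = 0)
    (h2 : (2 : F) ≠ 0) {E : Finset (Fin 3 → F)} (hE : ∀ x ∈ E, x 2 = x 0 ^ 2 + x 1 ^ 2)
    (hlarge : (Fintype.card F : ℝ) ^ 4 ≤ (#E : ℝ) ^ 3) (hq : (Fintype.card F : ℝ) ≤ #E) :
    (Fintype.card F : ℝ) ^ 2 * #(parallelChords E) ≤
      2 * (Fintype.card F : ℝ) ^ 3 * (#E : ℝ) ^ 2 + 5 * (#E : ℝ) ^ 4 := by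
  have hchords := card_parallelChords_le aniso h2 hE
  have hdist := sum_card_pairsAtDist_sq_le hE
  have htri := sum_card_coincidences_dotP_le E E (fun c => ![-2 * c 0, -2 * c 1, 1])
    (fun c _ h => one_ne_zero (congrFun h 2 : (1 : F) = 0)) (by
      intro s hs t ht c _ h
      have e0 : -2 * s 0 = c * (-2 * t 0) := congrFun h 0
      have e1 : -2 * s 1 = c * (-2 * t 1) := congrFun h 1
      have e2 : (1 : F) = c * 1 := congrFun h 2
      have hc : c = 1 := by rw [e2, mul_one]
      rw [hc, one_mul] at e0 e1
      exact eq_of_paraboloid hE hs ht (mul_left_cancel₀ (neg_ne_zero.mpr h2) e0)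
        (mul_left_cancel₀ (neg_ne_zero.mpr h2) e1))
  have hq1 : (1 : ℝ) ≤ Fintype.card F := by exact_mod_cast Fintype.card_pos
  set T : ℝ := ∑ c ∈ E, (#(coincidences E (dotP ![-2 * c 0, -2 * c 1, 1])) : ℝ)
  set N : ℝ := (#E : ℝ)
  set Q : ℝ := (#(parallelChords E) : ℝ)
  set q : ℝ := (Fintype.card F : ℝ)
  have hT : 0 ≤ T := Finset.sum_nonneg fun _ _ => by positivity
  have hQ0 : 0 ≤ Q := Nat.cast_nonneg _
  have hQ : q * Q ≤ 2 * q ^ 2 * N ^ 2 + N * T := by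
    have : q * N ^ 2 ≤ q ^ 2 * N ^ 2 := by gcongr; nlinarith
    linarith
  clear_value T N Q q
  have hN : 0 ≤ N := by linarith
  have hqN : q * N ^ 2 ≤ N ^ 3 := by nlinarith [mul_le_mul_of_nonneg_right hq (sq_nonneg N)]
  have hT5 : q * T ≤ 5 * N ^ 3 := by
    by_contra! hlt
    have hN3 : 0 ≤ N ^ 3 := by positivity
    have hle : q * T - 2 * N ^ 3 ≤ √(q ^ 3 * N * Q) := by nlinarith
    have hsq : (q * T - 2 * N ^ 3) ^ 2 ≤ q ^ 3 * N * Q :=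
      (Real.le_sqrt' (by nlinarith [pow_pos (show 0 < N by linarith) 3])).mp hle
    have hb : q ^ 3 * N * Q ≤ 2 * N ^ 3 * N ^ 3 + N ^ 3 * (q * T) :=
      calc q ^ 3 * N * Q = q ^ 2 * N * (q * Q) := by ring
        _ ≤ q ^ 2 * N * (2 * q ^ 2 * N ^ 2 + N * T) := by gcongr
        _ = 2 * q ^ 4 * N ^ 3 + q * N ^ 2 * (q * T) := by ring
        _ ≤ 2 * N ^ 3 * N ^ 3 + N ^ 3 * (q * T) := by
          have : 0 ≤ q * T := by positivity
          gcongr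
    have hN3' : 0 < N ^ 3 := pow_pos (by linarith) 3
    nlinarith [mul_pos hN3' (sub_pos.mpr hlt), sq_nonneg (q * T - 5 * N ^ 3), mul_pos hN3' hN3']
  calc q ^ 2 * Q = q * (q * Q) := by ring
    _ ≤ q * (2 * q ^ 2 * N ^ 2 + N * T) := by gcongr
    _ = 2 * q ^ 3 * N ^ 2 + N * (q * T) := by ring
    _ ≤ 2 * q ^ 3 * N ^ 2 + N * (5 * N ^ 3) := by gcongr
    _ = _ := by ring

theorem card_le_six_mul_card_prodSet (aniso : ∀ x y : F, x ^ 2 + y ^ 2 = 0 → x = 0 ∧ y = 0)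
    (h2 : (2 : F) ≠ 0) {E : Finset (Fin 3 → F)} (hE : ∀ x ∈ E, x 2 = x 0 ^ 2 + x 1 ^ 2)
    (hlarge : (Fintype.card F : ℝ) ^ 4 ≤ (#E : ℝ) ^ 3) :
    (Fintype.card F : ℝ) ≤ 6 * #(prodSet E) := by
  have hq1 : (1 : ℝ) < Fintype.card F := by exact_mod_cast Fintype.one_lt_card
  have hq : (Fintype.card F : ℝ) ≤ #E := by
    refine le_of_pow_le_pow_left₀ (n := 3) (by norm_num) (by positivity) (le_trans ?_ hlarge)
    exact pow_le_pow_right₀ hq1.le (by norm_num)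
  have hQ := card_parallelChords_le_of_large aniso h2 hE hlarge hq
  have hpin := sum_card_coincidences_dotP_le E (E.erase 0) (fun y => y)
    (fun y hy => ne_of_mem_erase hy) (by
      intro s hs t ht c hc h
      have hsE := mem_of_mem_erase hs
      have htE := mem_of_mem_erase ht
      have e0 : s 0 = c * t 0 := congrFun h 0
      have e1 : s 1 = c * t 1 := congrFun h 1
      have e2 : s 2 = c * t 2 := congrFun h 2
      have ht2 : t 2 ≠ 0 := by
        intro h0
        obtain ⟨z0, z1⟩ := aniso _ _ ((hE t htE).symm.trans h0)
        refine ne_of_mem_erase ht (funext fun i => ?_)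
        fin_cases i
        · exact z0
        · exact z1
        · exact h0
      have hc1 : c = 1 := by
        apply mul_left_cancel₀ (mul_ne_zero hc ht2)
        rw [hE s hsE, e0, e1] at e2
        linear_combination c ^ 2 * hE t htE + e2
      rw [h, hc1, one_smul])
  have hprod : (#(E.erase 0) : ℝ) * (#E : ℝ) ^ 2 ≤
      #(prodSet E) * ∑ y ∈ E.erase 0, (#(coincidences E (dotP y)) : ℝ) := by
    rw [← nsmul_eq_mul, Finset.mul_sum]
    refine Finset.card_nsmul_le_sum _ _ _ fun y hy => ?_
    exact_mod_cast card_sq_le_card_mul_card_coincidences E (dotP y) (prodSet E) fun x hx =>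
      mem_image.mpr ⟨(y, x), mem_product.mpr ⟨mem_of_mem_erase hy, hx⟩, rfl⟩
  have hM : (#E : ℝ) ≤ 2 * #(E.erase 0) := by
    have h1 : (#E : ℝ) ≤ #(E.erase 0) + 1 := by
      exact_mod_cast Nat.sub_le_iff_le_add.mp (Finset.pred_card_le_card_erase (s := E) (a := 0))
    have h3 : (1 : ℝ) < #E := hq1.trans_le hq
    have h4 : (1 : ℝ) ≤ #(E.erase 0) := by
      have : 0 < #(E.erase 0) := by
        have : (0 : ℝ) < #(E.erase 0) := by linarith
        exact_mod_cast this
      exact_mod_cast this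
    linarith
  set T : ℝ := ∑ y ∈ E.erase 0, (#(coincidences E (dotP y)) : ℝ)
  set N : ℝ := (#E : ℝ)
  set M : ℝ := (#(E.erase 0) : ℝ)
  set Q : ℝ := (#(parallelChords E) : ℝ)
  set q : ℝ := (Fintype.card F : ℝ)
  set P : ℝ := (#(prodSet E) : ℝ)
  have hP : 0 ≤ P := Nat.cast_nonneg _
  clear_value T N M Q q P
  have hN : 0 < N := by linarith
  have hM0 : 0 < M := by linarith
  have hroot : √(q ^ 3 * M * Q) ≤ 4 * (M * N ^ 2) := by
    refine Real.sqrt_le_iff.mpr ⟨by positivity, ?_⟩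
    calc q ^ 3 * M * Q = q * M * (q ^ 2 * Q) := by ring
      _ ≤ q * M * (2 * q ^ 3 * N ^ 2 + 5 * N ^ 4) := by gcongr
      _ = 2 * q ^ 4 * M * N ^ 2 + 5 * q * M * N ^ 4 := by ring
      _ ≤ 2 * N ^ 3 * M * N ^ 2 + 5 * N * M * N ^ 4 := by gcongr
      _ = 7 * N * (M * N ^ 4) := by ring
      _ ≤ 7 * (2 * M) * (M * N ^ 4) := by gcongr
      _ ≤ (4 * (M * N ^ 2)) ^ 2 := by nlinarith [sq_nonneg (M * N ^ 2)]
  have hT : q * T ≤ 6 * (M * N ^ 2) := by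
    have : q * M * N ≤ N * M * N := by gcongr
    nlinarith
  have hpos : 0 < M * N ^ 2 := by positivity
  refine le_of_mul_le_mul_right ?_ hpos
  calc q * (M * N ^ 2) ≤ q * (P * T) := by gcongr
    _ = P * (q * T) := by ring
    _ ≤ P * (6 * (M * N ^ 2)) := by gcongr
    _ = _ := by ring

end IsoscelesTriangles

theorem sq_add_sq_eq_zero_of_not_isSquare_neg_one {F : Type*} [Field F]
    (h : ¬IsSquare (-1 : F)) (x y : F) (hxy : x ^ 2 + y ^ 2 = 0) : x = 0 ∧ y = 0 := by
  have hy : y = 0 := by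
    by_contra hy
    refine h ⟨x / y, ?_⟩
    field_simp
    linear_combination -hxy
  exact ⟨by simpa [hy] using hxy, hy⟩

/-- there are absolute constants `C, c > 0` such that for any prime power
`q ≡ 3 (mod 4)` and `E ⊆ P₃ ⊆ 𝔽_q³`, if `|E| ≥ C q^{4/3}` then `|∏(E)| ≥ c q`. -/
theorem stmt2 :
    ∃ C c : ℝ, 0 < C ∧ 0 < c ∧
      ∀ (F : Type) [Field F] [Fintype F] [DecidableEq F],
        Fintype.card F % 4 = 3 →
        ∀ E : Finset (Fin 3 → F),
          (∀ x ∈ E, x 2 = x 0 ^ 2 + x 1 ^ 2) →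
          C * (Fintype.card F : ℝ) ^ ((4 : ℝ) / 3) ≤ (E.card : ℝ) →
          c * (Fintype.card F : ℝ) ≤ ((prodSet E).card : ℝ) := by
  refine ⟨1, 1 / 6, one_pos, by norm_num, ?_⟩
  intro F _ _ _ hF E hE hcard
  have hns : ¬IsSquare (-1 : F) := fun h => FiniteField.isSquare_neg_one_iff.mp h hF
  have h2 : (2 : F) ≠ 0 := fun h => hns ⟨1, by linear_combination -h⟩
  have hlarge : (Fintype.card F : ℝ) ^ 4 ≤ (#E : ℝ) ^ 3 := by
    rw [one_mul] at hcard
    calc (Fintype.card F : ℝ) ^ 4 = ((Fintype.card F : ℝ) ^ ((4 : ℝ) / 3)) ^ 3 := by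
          rw [← Real.rpow_natCast, ← Real.rpow_natCast, ← Real.rpow_mul (Nat.cast_nonneg _)]
          norm_num
      _ ≤ _ := by gcongr
  have := card_le_six_mul_card_prodSet (sq_add_sq_eq_zero_of_not_isSquare_neg_one hns) h2 hE hlarge
  linarith
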